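/- Let λ>0 and b∈(0,1). There exists N∈ℕ such that for every integer m ≥ N and each sign σ∈{+,−}, one has Δ_m(λ,b) > 0 and ( Λ_1(λ,b) − b·(Ω_m(λb) + Ω_m^σ(λ,b)) )² ≠ b²·Λ_m(λ,b)². (This inequality is the transversality condition of Crandall–Rabinowitz: it expresses that ∂_Ω DG(λ,b,Ω_m^σ(λ,b),0,0) applied to the kernel generator does not belong to the range of DG(λ,b,Ω_m^σ(λ,b),0,0).) -/

import Mathlib

open Real MeasureTheory Filter

/-- Modified Bessel function of the first kind `I_n`. -/
noncomputable def besselI (n : ℕ) (x : ℝ) : ℝ :=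
  ∑' m : ℕ, (x / 2) ^ (n + 2 * m) / ((Nat.factorial m : ℝ) * (Nat.factorial (n + m) : ℝ))

/-- Modified Bessel function of the second kind `K_n`. -/
noncomputable def besselK (n : ℕ) (x : ℝ) : ℝ :=
  ∫ t in Set.Ioi (0 : ℝ), Real.exp (-x * Real.cosh t) * Real.cosh ((n : ℝ) * t)

/-- `Λ_n(λ,b) = I_n(λb) K_n(λ)`. -/
noncomputable def Lam (n : ℕ) (l b : ℝ) : ℝ := besselI n (l * b) * besselK n l

/-- `Ω_n(x) = I_1(x)K_1(x) − I_n(x)K_n(x)`. -/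
noncomputable def Om (n : ℕ) (x : ℝ) : ℝ :=
  besselI 1 x * besselK 1 x - besselI n x * besselK n x

/-- Discriminant `Δ_n(λ,b)`. -/
noncomputable def Del (n : ℕ) (l b : ℝ) : ℝ :=
  (b * (Om n l + Om n (l * b)) - (1 + b ^ 2) * Lam 1 l b) ^ 2 - 4 * b ^ 2 * Lam n l b ^ 2

/-- `B_n(λ,b)`. -/
noncomputable def Bfun (n : ℕ) (l b : ℝ) : ℝ :=
  (1 - b ^ 2) * Lam 1 l b + b * (Om n l - Om n (l * b))

/-- `Ω_n^+(λ,b)`. -/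
noncomputable def OmP (n : ℕ) (l b : ℝ) : ℝ :=
  (Bfun n l b + Real.sqrt (Del n l b)) / (2 * b)

/-- `Ω_n^−(λ,b)`. -/
noncomputable def OmM (n : ℕ) (l b : ℝ) : ℝ :=
  (Bfun n l b - Real.sqrt (Del n l b)) / (2 * b)

/-- The matrix `M_n(λ,b,Ω)`. -/
noncomputable def Mmat (n : ℕ) (l b W : ℝ) : Matrix (Fin 2) (Fin 2) ℝ :=
  !![Om n l - W - b * Lam 1 l b, b * Lam n l b;
     -Lam n l b, Lam 1 l b - b * (Om n (l * b) + W)]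

lemma besselI_term_le (n m : ℕ) {x : ℝ} (hx : 0 ≤ x) :
    (x / 2) ^ (n + 2 * m) / ((Nat.factorial m : ℝ) * (Nat.factorial (n + m) : ℝ)) ≤
      (x / 2) ^ n / (Nat.factorial n : ℝ) * (((x / 2) ^ 2) ^ m / (Nat.factorial m : ℝ)) := by
  have hn : (0 : ℝ) < Nat.factorial n := by exact_mod_cast Nat.factorial_pos n
  have hm : (0 : ℝ) < Nat.factorial m := by exact_mod_cast Nat.factorial_pos m
  have h : (Nat.factorial n : ℝ) ≤ Nat.factorial (n + m) := by
    exact_mod_cast Nat.factorial_le (Nat.le_add_right n m)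
  rw [div_mul_div_comm, ← pow_mul, ← pow_add, mul_comm (Nat.factorial n : ℝ)]
  gcongr

lemma summable_besselI (n : ℕ) {x : ℝ} (hx : 0 ≤ x) :
    Summable fun m : ℕ ↦
      (x / 2) ^ (n + 2 * m) / ((Nat.factorial m : ℝ) * (Nat.factorial (n + m) : ℝ)) :=
  Summable.of_nonneg_of_le (fun m ↦ by positivity) (fun m ↦ besselI_term_le n m hx)
    ((Real.summable_pow_div_factorial _).mul_left _)

lemma besselI_pos (n : ℕ) {x : ℝ} (hx : 0 < x) : 0 < besselI n x :=
  (summable_besselI n hx.le).tsum_pos (fun m ↦ by positivity) 0 (by positivity)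

lemma besselI_le (n : ℕ) {x : ℝ} (hx : 0 ≤ x) :
    besselI n x ≤ (x / 2) ^ n / (Nat.factorial n : ℝ) * Real.exp ((x / 2) ^ 2) := by
  rw [Real.exp_eq_exp_ℝ, NormedSpace.exp_eq_tsum_div, ← tsum_mul_left]
  exact (summable_besselI n hx).tsum_le_tsum (fun m ↦ besselI_term_le n m hx)
    ((Real.summable_pow_div_factorial _).mul_left _)

lemma besselI_mul_le (n : ℕ) {x b : ℝ} (hx : 0 ≤ x) (hb : 0 ≤ b) (hb1 : b ≤ 1) :
    besselI n (x * b) ≤ b ^ n * besselI n x := by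
  unfold besselI
  rw [← tsum_mul_left]
  refine (summable_besselI n (mul_nonneg hx hb)).tsum_le_tsum (fun m ↦ ?_)
    ((summable_besselI n hx).mul_left _)
  rw [← mul_div_assoc]
  gcongr
  rw [mul_div_right_comm, mul_pow, mul_comm]
  gcongr ?_ * _
  exact pow_le_pow_of_le_one hb hb1 (Nat.le_add_right _ _)

lemma integrableOn_pow_mul_exp (n : ℕ) {r : ℝ} (hr : 0 < r) :
    IntegrableOn (fun u : ℝ ↦ u ^ n * Real.exp (-(r * u))) (Set.Ioi 0) := by
  have h := integrableOn_rpow_mul_exp_neg_mul_rpow (p := 1) (s := n)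
    (by have : (0 : ℝ) ≤ n := n.cast_nonneg
        linarith) one_pos hr
  simpa using h

lemma integral_pow_mul_exp (n : ℕ) {r : ℝ} (hr : 0 < r) :
    ∫ u in Set.Ioi (0 : ℝ), u ^ n * Real.exp (-(r * u)) =
      (1 / r) ^ (n + 1) * (Nat.factorial n : ℝ) := by
  have h := Real.integral_rpow_mul_exp_neg_mul_Ioi (a := (n : ℝ) + 1) (by positivity) hr
  rw [Real.Gamma_nat_eq_factorial] at h
  have e : ((n : ℝ) + 1) = ((n + 1 : ℕ) : ℝ) := by push_cast; rfl
  rw [add_sub_cancel_right] at h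
  rw [e] at h
  simpa only [Real.rpow_natCast] using h

lemma integrableOn_exp_comp (n : ℕ) {r : ℝ} (hr : 0 < r) :
    IntegrableOn (fun t : ℝ ↦ |Real.exp t| • (Real.exp t ^ n * Real.exp (-(r * Real.exp t))))
      (Set.Ioi 0) := by
  rw [← integrableOn_image_iff_integrableOn_abs_deriv_smul measurableSet_Ioi
    (fun t _ ↦ (Real.hasDerivAt_exp t).hasDerivWithinAt) Real.exp_injective.injOn
    (fun u : ℝ ↦ u ^ n * Real.exp (-(r * u)))]
  refine (integrableOn_pow_mul_exp n hr).mono_set ?_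
  rintro _ ⟨t, -, rfl⟩
  exact Real.exp_pos t

lemma integral_exp_comp_le (n : ℕ) {r : ℝ} (hr : 0 < r) :
    ∫ t in Set.Ioi (0 : ℝ),
        |Real.exp t| • (Real.exp t ^ n * Real.exp (-(r * Real.exp t))) ≤
      (1 / r) ^ (n + 1) * (Nat.factorial n : ℝ) := by
  rw [← integral_image_eq_integral_abs_deriv_smul measurableSet_Ioi
    (fun t _ ↦ (Real.hasDerivAt_exp t).hasDerivWithinAt) Real.exp_injective.injOn
    (fun u : ℝ ↦ u ^ n * Real.exp (-(r * u))), ← integral_pow_mul_exp n hr]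
  refine setIntegral_mono_set (integrableOn_pow_mul_exp n hr) ?_ ?_
  · filter_upwards [ae_restrict_mem measurableSet_Ioi] with u hu
    have : (0 : ℝ) < u := hu
    simp only [Pi.zero_apply]
    positivity
  · refine LE.le.eventuallyLE ?_
    rintro _ ⟨t, -, rfl⟩
    exact Real.exp_pos t

lemma besselK_integrand_le (n : ℕ) {x t : ℝ} (hx : 0 ≤ x) (ht : 0 ≤ t) :
    Real.exp (-x * Real.cosh t) * Real.cosh (((n + 1 : ℕ) : ℝ) * t) ≤
      |Real.exp t| • (Real.exp t ^ n * Real.exp (-(x / 2 * Real.exp t))) := by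
  have h1 : Real.exp (-x * Real.cosh t) ≤ Real.exp (-(x / 2 * Real.exp t)) := by
    apply Real.exp_le_exp.2
    rw [Real.cosh_eq]
    nlinarith [mul_nonneg hx (Real.exp_pos (-t)).le]
  have h2 : Real.cosh (((n + 1 : ℕ) : ℝ) * t) ≤ Real.exp t ^ (n + 1) := by
    rw [← Real.exp_nat_mul, Real.cosh_eq]
    have h0 : 0 ≤ ((n + 1 : ℕ) : ℝ) * t := by positivity
    have : Real.exp (-(((n + 1 : ℕ) : ℝ) * t)) ≤ Real.exp (((n + 1 : ℕ) : ℝ) * t) :=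
      Real.exp_le_exp.2 (by linarith)
    linarith
  rw [Real.abs_exp, smul_eq_mul, ← mul_assoc, ← pow_succ', mul_comm]
  exact mul_le_mul h2 h1 (Real.exp_pos _).le (by positivity)

lemma integrableOn_besselK (n : ℕ) {x : ℝ} (hx : 0 < x) :
    IntegrableOn (fun t : ℝ ↦ Real.exp (-x * Real.cosh t) * Real.cosh (((n + 1 : ℕ) : ℝ) * t))
      (Set.Ioi 0) := by
  refine Integrable.mono' (integrableOn_exp_comp n (half_pos hx)) ?_ ?_
  · exact Continuous.aestronglyMeasurable (by fun_prop)
  · filter_upwards [ae_restrict_mem measurableSet_Ioi] with t ht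
    rw [Real.norm_of_nonneg (mul_nonneg (Real.exp_pos _).le (Real.cosh_pos _).le)]
    exact besselK_integrand_le n hx.le (le_of_lt ht)

lemma besselK_succ_le (n : ℕ) {x : ℝ} (hx : 0 < x) :
    besselK (n + 1) x ≤ (2 / x) ^ (n + 1) * (Nat.factorial n : ℝ) := by
  have h := integral_exp_comp_le n (half_pos hx)
  rw [one_div_div] at h
  refine le_trans ?_ h
  exact setIntegral_mono_on (integrableOn_besselK n hx) (integrableOn_exp_comp n (half_pos hx))
    measurableSet_Ioi fun t ht ↦ besselK_integrand_le n hx.le (le_of_lt ht)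

lemma besselK_succ_pos (n : ℕ) {x : ℝ} (hx : 0 < x) : 0 < besselK (n + 1) x := by
  have hpos : ∀ t : ℝ,
      0 < Real.exp (-x * Real.cosh t) * Real.cosh (((n + 1 : ℕ) : ℝ) * t) := fun t ↦
    mul_pos (Real.exp_pos _) (Real.cosh_pos _)
  refine (setIntegral_pos_iff_support_of_nonneg_ae
    (Eventually.of_forall fun t ↦ (hpos t).le) (integrableOn_besselK n hx)).2 ?_
  rw [Function.support_eq_univ fun t ↦ (hpos t).ne', Set.univ_inter]
  simp

lemma besselK_succ_anti (n : ℕ) {x y : ℝ} (hx : 0 < x) (hxy : x ≤ y) :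
    besselK (n + 1) y ≤ besselK (n + 1) x := by
  refine setIntegral_mono_on (integrableOn_besselK n (hx.trans_le hxy))
    (integrableOn_besselK n hx) measurableSet_Ioi fun t _ ↦ ?_
  have := Real.cosh_pos t
  have := Real.cosh_pos (((n + 1 : ℕ) : ℝ) * t)
  gcongr

lemma besselI_mul_besselK_succ_le (n : ℕ) {x : ℝ} (hx : 0 < x) :
    besselI (n + 1) x * besselK (n + 1) x ≤ Real.exp ((x / 2) ^ 2) * (1 / ((n : ℝ) + 1)) := by
  refine (mul_le_mul (besselI_le (n + 1) hx.le) (besselK_succ_le n hx)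
    (besselK_succ_pos n hx).le (by positivity)).trans_eq ?_
  rw [Nat.factorial_succ]
  have : (Nat.factorial n : ℝ) ≠ 0 := by exact_mod_cast Nat.factorial_ne_zero n
  push_cast
  rw [div_pow x 2 (n + 1), div_pow 2 x]
  field_simp

lemma tendsto_besselI_mul_besselK {x : ℝ} (hx : 0 < x) :
    Tendsto (fun n ↦ besselI n x * besselK n x) atTop (nhds 0) := by
  rw [← tendsto_add_atTop_iff_nat 1]
  refine squeeze_zero
    (fun n ↦ (mul_pos (besselI_pos _ hx) (besselK_succ_pos n hx)).le)
    (fun n ↦ besselI_mul_besselK_succ_le n hx) ?_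
  simpa using tendsto_one_div_add_atTop_nhds_zero_nat.const_mul (Real.exp ((x / 2) ^ 2))

lemma Lam_succ_pos (n : ℕ) {l b : ℝ} (hl : 0 < l) (hb : 0 < b) : 0 < Lam (n + 1) l b :=
  mul_pos (besselI_pos _ (mul_pos hl hb)) (besselK_succ_pos n hl)

lemma tendsto_Lam {l b : ℝ} (hl : 0 < l) (hb : b ∈ Set.Ioo (0 : ℝ) 1) :
    Tendsto (fun n ↦ Lam n l b) atTop (nhds 0) := by
  have h := (tendsto_add_atTop_iff_nat 1).2 (tendsto_besselI_mul_besselK hl)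
  rw [← tendsto_add_atTop_iff_nat 1]
  refine squeeze_zero (fun n ↦ (Lam_succ_pos n hl hb.1).le) (fun n ↦ ?_) h
  refine mul_le_mul_of_nonneg_right ?_ (besselK_succ_pos n hl).le
  refine (besselI_mul_le (n + 1) hl.le hb.1.le hb.2.le).trans ?_
  exact mul_le_of_le_one_left (besselI_pos _ hl).le (pow_le_one₀ hb.1.le hb.2.le)

lemma tendsto_Om {x : ℝ} (hx : 0 < x) :
    Tendsto (fun n ↦ Om n x) atTop (nhds (besselI 1 x * besselK 1 x)) := by
  simpa [Om] using (tendsto_besselI_mul_besselK hx).const_sub (besselI 1 x * besselK 1 x)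

lemma discriminant_base_limit_pos {l b : ℝ} (hl : 0 < l) (hb : b ∈ Set.Ioo (0 : ℝ) 1) :
    0 < b * (besselI 1 l * besselK 1 l + besselI 1 (l * b) * besselK 1 (l * b))
      - (1 + b ^ 2) * Lam 1 l b := by
  obtain ⟨hb0, hb1⟩ := hb
  have hlb : 0 < l * b := mul_pos hl hb0
  have hI := besselI_pos 1 hlb
  have hK : 0 < besselK 1 l := besselK_succ_pos 0 hl
  have h1 : besselI 1 (l * b) ≤ b * besselI 1 l := by
    simpa using besselI_mul_le 1 hl.le hb0.le hb1.le
  have h2 : besselK 1 l ≤ besselK 1 (l * b) :=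
    besselK_succ_anti 0 hlb (mul_le_of_le_one_right hl.le hb1.le)
  have h3 := mul_le_mul_of_nonneg_right h1 hK.le
  have h4 := mul_le_mul_of_nonneg_left h2 (mul_pos hb0 hI).le
  have h5 := mul_pos (mul_pos (mul_pos hb0 hI) hK) (sub_pos.2 hb1)
  unfold Lam
  nlinarith

/-- A root of `x² + Ax + c²` with nonzero discriminant and `c ≠ 0` does not satisfy
`x² = c²`. -/
lemma sq_ne_of_root {A c s : ℝ} (hc : c ≠ 0) (hs : s ≠ 0) (h : s ^ 2 = A ^ 2 - 4 * c ^ 2) :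
    ((-A - s) / 2) ^ 2 ≠ c ^ 2 := by
  intro h'
  have h1 : s * (A + s) = 0 := by linarith
  have h2 : A = -s := by
    rcases mul_eq_zero.1 h1 with h0 | h0
    · exact absurd h0 hs
    · linarith
  have h3 : c ^ 2 = 0 := by subst h2; linarith
  exact hc (pow_eq_zero_iff two_ne_zero |>.1 h3)

/-- transversality condition of Crandall–Rabinowitz: for `m` large,
`Δ_m(λ,b) > 0` and `(Λ_1(λ,b) − b(Ω_m(λb)+Ω_m^±(λ,b)))² ≠ b²Λ_m(λ,b)²`. -/
theorem transversality (l b : ℝ) (hl : 0 < l) (hb : b ∈ Set.Ioo (0:ℝ) 1) :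
    ∃ N : ℕ, ∀ m : ℕ, N ≤ m →
      0 < Del m l b ∧
      (Lam 1 l b - b * (Om m (l * b) + OmP m l b)) ^ 2 ≠ b ^ 2 * Lam m l b ^ 2 ∧
      (Lam 1 l b - b * (Om m (l * b) + OmM m l b)) ^ 2 ≠ b ^ 2 * Lam m l b ^ 2 := by
  have hA := ((((tendsto_Om hl).add (tendsto_Om (mul_pos hl hb.1))).const_mul b).sub_const
    ((1 + b ^ 2) * Lam 1 l b)).sub ((tendsto_Lam hl hb).const_mul (2 * b))
  rw [mul_zero, sub_zero] at hA
  obtain ⟨N, hN⟩ := eventually_atTop.1 (hA.eventually (lt_mem_nhds (discriminant_base_limit_pos hl hb)))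
  refine ⟨N + 1, fun m hm ↦ ?_⟩
  have hgap := hN m (by omega)
  obtain ⟨k, rfl⟩ : ∃ k, m = k + 1 := ⟨m - 1, by omega⟩
  have hc : 0 < b * Lam (k + 1) l b := mul_pos hb.1 (Lam_succ_pos k hl hb.1)
  have hD : 0 < Del (k + 1) l b := by
    unfold Del
    nlinarith
  have hs := Real.sqrt_pos.2 hD
  have hsq := Real.sq_sqrt hD.le
  have hb0 : b ≠ 0 := hb.1.ne'
  refine ⟨hD, ?_, ?_⟩
  · convert sq_ne_of_root (A := b * (Om (k + 1) l + Om (k + 1) (l * b)) - (1 + b ^ 2) * Lam 1 l b)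
      hc.ne' hs.ne' (by rw [hsq, Del]; ring) using 2
    · unfold OmP Bfun
      field_simp
      ring
    · ring
  · convert sq_ne_of_root (A := b * (Om (k + 1) l + Om (k + 1) (l * b)) - (1 + b ^ 2) * Lam 1 l b)
      hc.ne' (neg_ne_zero.2 hs.ne') (by rw [neg_sq, hsq, Del]; ring) using 2
    · unfold OmM Bfun
      field_simp
      ring
    · ring
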